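/- (Two-sided test: type I error control, finite-horizon form.) Fix an adaptive measurement scheme with horizon t, disjoint sets S₀ and S₁ of density matrices on ℂ^d, null and alternative MLE maps ρ̂₀^s and ρ̂₁^s for all 0 ≤ s ≤ t, and assume Tr(ρ^{⊗n_i} M^i(h)_x) > 0 for every ρ ∈ S₀ ∪ S₁, round i, history h, and outcome x. Let Λ₀^s and Λ₁^s be the associated split likelihood ratio and reversed split likelihood ratio, and fix ε₀, ε₁ ∈ (0,1). For x ∈ X^t, say the two-sided test rejects H₀ on x if there exists s ≤ t such that Λ₀^s(x) ≥ 1/ε₀ while Λ₀^r(x) < 1/ε₀ and Λ₁^r(x) < 1/ε₁ for all r < s. Then for every ρ ∈ S₀, the rejection probability is at most ε₀: ∑_{x ∈ X^t : the test rejects H₀ on x} P_ρ(x) ≤ ε₀. -/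

import Mathlib

open Matrix BigOperators
open scoped ComplexOrder

noncomputable section

/-- A density matrix on `ℂ^d`: positive semidefinite with trace 1. -/
def IsDensityMatrix {d : ℕ} (ρ : Matrix (Fin d) (Fin d) ℂ) : Prop :=
  ρ.PosSemidef ∧ ρ.trace = 1

/-- A POVM with finite outcome set `X`: positive semidefinite effects summing to the identity. -/
def IsPOVM {m : Type*} [Fintype m] [DecidableEq m] {X : Type*} [Fintype X]
    (M : X → Matrix m m ℂ) : Prop :=
  (∀ x, (M x).PosSemidef) ∧ ∑ x, M x = 1

/-- The `n`-fold tensor power of a `d × d` matrix, indexed by tuples in `Fin n → Fin d`,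
with entries `(ρ^{⊗n})_{x,y} = ∏ i, ρ (x i) (y i)`. -/
def tensorPow {d : ℕ} (ρ : Matrix (Fin d) (Fin d) ℂ) (n : ℕ) :
    Matrix (Fin n → Fin d) (Fin n → Fin d) ℂ :=
  fun x y => ∏ i, ρ (x i) (y i)

/-- Born probability `Tr(ρ M)` as the associated (nonnegative) real number. -/
def bornProb {m : Type*} [Fintype m] (ρ M : Matrix m m ℂ) : ℝ :=
  ((ρ * M).trace).re

/-- An adaptive measurement scheme with horizon `t`: at round `i` (0-based), given a
history `h ∈ X^i`, it measures `n i ≥ 1` fresh copies with the POVM `M i h`. -/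
structure AdaptiveScheme (d : ℕ) (X : Type*) [Fintype X] (t : ℕ) where
  n : Fin t → ℕ
  hn : ∀ i, 1 ≤ n i
  M : (i : Fin t) → (Fin i → X) → X →
        Matrix (Fin (n i) → Fin d) (Fin (n i) → Fin d) ℂ
  hM : ∀ i h, IsPOVM (M i h)

/-- The history (first `i` outcomes) of an outcome sequence `x`. -/
def hist {X : Type*} {t : ℕ} (x : Fin t → X) (i : Fin t) : Fin i → X :=
  fun j => x ⟨j, j.isLt.trans i.isLt⟩

/-- Probability of observing the outcome sequence `x` under state `ρ`. -/
def seqProb {d t : ℕ} {X : Type*} [Fintype X] (S : AdaptiveScheme d X t)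
    (ρ : Matrix (Fin d) (Fin d) ℂ) (x : Fin t → X) : ℝ :=
  ∏ i, bornProb (tensorPow ρ (S.n i)) (S.M i (hist x i) (x i))

/-- Likelihood of the first `s` outcomes of a history `h ∈ X^s` under state `ρ`:
`∏_{i=1}^{s} Tr(ρ^{⊗ n_i} M^i(h_1,…,h_{i-1})_{h_i})` (rounds beyond the horizon contribute 1). -/
def likOnHist {d t : ℕ} {X : Type*} [Fintype X] (S : AdaptiveScheme d X t)
    (ρ : Matrix (Fin d) (Fin d) ℂ) (s : ℕ) (h : Fin s → X) : ℝ :=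
  ∏ i : Fin t, if hi : (i : ℕ) < s then
    bornProb (tensorPow ρ (S.n i))
      (S.M i (fun j => h ⟨j, j.isLt.trans hi⟩) (h ⟨i, hi⟩))
  else 1

/-- An MLE map for the class `S₀`: at each time `s ≤ t` and history `h ∈ X^s`, it returns a
state of `S₀` maximizing the likelihood of `h` over `S₀`. -/
def IsMLEMap {d t : ℕ} {X : Type*} [Fintype X] (S : AdaptiveScheme d X t)
    (S₀ : Set (Matrix (Fin d) (Fin d) ℂ))
    (est : (s : ℕ) → (Fin s → X) → Matrix (Fin d) (Fin d) ℂ) : Prop :=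
  ∀ s : ℕ, s ≤ t → ∀ h : Fin s → X,
    est s h ∈ S₀ ∧ ∀ ρ' ∈ S₀, likOnHist S ρ' s h ≤ likOnHist S (est s h) s h

/-- The split likelihood ratio at time `s ≤ t`:
`Λ₀^s(x) = ∏_{i=1}^{s} Tr((ρ̂₁^{i-1}(x_{<i}))^{⊗n_i} M^i_{x_i}) / Tr((ρ̂₀^{s}(x_{≤s}))^{⊗n_i} M^i_{x_i})`,
with non-anticipating alternative MLEs in the numerator and the time-`s` null MLE in the
denominator. -/
def slr₀ {d t : ℕ} {X : Type*} [Fintype X] (S : AdaptiveScheme d X t)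
    (est₀ est₁ : (s : ℕ) → (Fin s → X) → Matrix (Fin d) (Fin d) ℂ)
    (x : Fin t → X) (s : ℕ) (hs : s ≤ t) : ℝ :=
  ∏ i : Fin t, if (i : ℕ) < s then
    bornProb (tensorPow (est₁ i (hist x i)) (S.n i)) (S.M i (hist x i) (x i)) /
      bornProb (tensorPow (est₀ s (fun j => x (Fin.castLE hs j))) (S.n i))
        (S.M i (hist x i) (x i))
  else 1

/-- The reversed split likelihood ratio at time `s ≤ t`, exchanging the roles of the null and
alternative hypotheses:
`Λ₁^s(x) = ∏_{i=1}^{s} Tr((ρ̂₀^{i-1}(x_{<i}))^{⊗n_i} M^i_{x_i}) / Tr((ρ̂₁^{s}(x_{≤s}))^{⊗n_i} M^i_{x_i})`. -/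
def slr₁ {d t : ℕ} {X : Type*} [Fintype X] (S : AdaptiveScheme d X t)
    (est₀ est₁ : (s : ℕ) → (Fin s → X) → Matrix (Fin d) (Fin d) ℂ)
    (x : Fin t → X) (s : ℕ) (hs : s ≤ t) : ℝ :=
  ∏ i : Fin t, if (i : ℕ) < s then
    bornProb (tensorPow (est₀ i (hist x i)) (S.n i)) (S.M i (hist x i) (x i)) /
      bornProb (tensorPow (est₁ s (fun j => x (Fin.castLE hs j))) (S.n i))
        (S.M i (hist x i) (x i))
  else 1

/-- The two-sided QSUT rejects `H₀` on `x`: at some time `s ≤ t` the split likelihood ratio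
crosses `1/ε₀`, while at all earlier times neither process had crossed its threshold. -/
def RejectsNull {d t : ℕ} {X : Type*} [Fintype X] (S : AdaptiveScheme d X t)
    (est₀ est₁ : (s : ℕ) → (Fin s → X) → Matrix (Fin d) (Fin d) ℂ)
    (ε₀ ε₁ : ℝ) (x : Fin t → X) : Prop :=
  ∃ s : ℕ, ∃ hs : s ≤ t, 1 / ε₀ ≤ slr₀ S est₀ est₁ x s hs ∧
    ∀ r : ℕ, ∀ hr : r < s,
      slr₀ S est₀ est₁ x r (le_of_lt (lt_of_lt_of_le hr hs)) < 1 / ε₀ ∧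
      slr₁ S est₀ est₁ x r (le_of_lt (lt_of_lt_of_le hr hs)) < 1 / ε₁

/-- The trace of a tensor power is the power of the trace. -/
theorem trace_tensorPow {d : ℕ} (ρ : Matrix (Fin d) (Fin d) ℂ) (n : ℕ) :
    (tensorPow ρ n).trace = ρ.trace ^ n := by
  simp only [Matrix.trace, Matrix.diag, tensorPow]
  rw [Fintype.sum_pow]

/-- The Born probabilities of a POVM in a trace-one tensor power sum to one. -/
theorem sum_bornProb_tensorPow {d n : ℕ} {X : Type*} [Fintype X]
    {ρ : Matrix (Fin d) (Fin d) ℂ} (hρ : ρ.trace = 1)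
    {M : X → Matrix (Fin n → Fin d) (Fin n → Fin d) ℂ} (hM : IsPOVM M) :
    ∑ x, bornProb (tensorPow ρ n) (M x) = 1 := by
  simp only [bornProb]
  rw [← Complex.re_sum, ← Matrix.trace_sum, ← Finset.mul_sum, hM.2, mul_one, trace_tensorPow, hρ]
  simp

/-- A sequence of conditional probability weights multiplies to a probability weight on
outcome sequences. -/
theorem sum_prod_hist_eq_one {X : Type*} [Fintype X] : ∀ {t : ℕ}
    (k : (i : Fin t) → (Fin i → X) → X → ℝ) (_ : ∀ i h, ∑ x, k i h x = 1),
    ∑ x : Fin t → X, ∏ i, k i (hist x i) (x i) = 1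
  | 0, _, _ => by simp
  | t + 1, k, hk => by
    rw [← (Fin.snocEquiv fun _ => X).sum_comp, Fintype.sum_prod_type_right]
    have hsplit (y : Fin t → X) (a : X) :
        ∏ i, k i (hist (Fin.snoc (α := fun _ => X) y a) i) (Fin.snoc (α := fun _ => X) y a i) =
          (∏ i : Fin t, k i.castSucc (hist y i) (y i)) * k (Fin.last t) y a := by
      rw [Fin.prod_univ_castSucc]
      congr 1
      · refine Finset.prod_congr rfl fun i _ => ?_
        rw [Fin.snoc_castSucc]
        congr 1
        funext j
        exact Fin.snoc_castSucc (α := fun _ => X) a y ⟨j, j.isLt.trans i.isLt⟩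
      · rw [Fin.snoc_last]
        congr 1
        funext j
        exact Fin.snoc_castSucc (α := fun _ => X) a y j
    change ∑ y : Fin t → X, ∑ a : X,
      ∏ i, k i (hist (Fin.snoc (α := fun _ => X) y a) i) (Fin.snoc (α := fun _ => X) y a i) = 1
    simp only [hsplit, ← Finset.mul_sum, hk, mul_one]
    exact sum_prod_hist_eq_one (fun i : Fin t => k i.castSucc) fun i h => hk i.castSucc h

/-- The likelihood of the first `s` outcomes under the conditional weights `k`. -/
def prefixLik {X : Type*} {t : ℕ} (k : (i : Fin t) → (Fin i → X) → X → ℝ)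
    (s : ℕ) (h : Fin s → X) : ℝ :=
  ∏ i : Fin t, if hi : (i : ℕ) < s then
    k i (fun j => h ⟨j, j.isLt.trans hi⟩) (h ⟨i, hi⟩)
  else 1

theorem prefixLik_castLE {X : Type*} {t : ℕ} (k : (i : Fin t) → (Fin i → X) → X → ℝ)
    (x : Fin t → X) {s : ℕ} (hs : s ≤ t) :
    prefixLik k s (fun j => x (Fin.castLE hs j)) =
      ∏ i : Fin t, if (i : ℕ) < s then k i (hist x i) (x i) else 1 := by
  refine Finset.prod_congr rfl fun i _ => ?_
  split_ifs <;> rfl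

open Classical in
/-- **Ville's inequality** for likelihood ratios over a finite horizon: under `p`, the
likelihood ratio of `q` against `p` ever reaches `c` with probability at most `1 / c`. -/
theorem mul_sum_prod_hist_le_one {X : Type*} [Fintype X] {t : ℕ}
    (p q : (i : Fin t) → (Fin i → X) → X → ℝ)
    (hp : ∀ i h x, 0 ≤ p i h x) (hq : ∀ i h x, 0 ≤ q i h x)
    (hp_sum : ∀ i h, ∑ x, p i h x = 1) (hq_sum : ∀ i h, ∑ x, q i h x = 1)
    (c : ℝ) (E : (Fin t → X) → Prop)
    (hE : ∀ x, E x → ∃ s, ∃ hs : s ≤ t, c * prefixLik p s (fun j => x (Fin.castLE hs j)) ≤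
      prefixLik q s (fun j => x (Fin.castLE hs j))) :
    c * ∑ x : Fin t → X, (if E x then ∏ i, p i (hist x i) (x i) else 0) ≤ 1 := by
  -- Follow `q` until the ratio reaches `c`, and `p` afterwards.
  let stopped (i : ℕ) (h : Fin i → X) : Prop := ∃ s, ∃ hs : s ≤ i,
    c * prefixLik p s (fun j => h (Fin.castLE hs j)) ≤
      prefixLik q s (fun j => h (Fin.castLE hs j))
  let r (i : Fin t) (h : Fin i → X) (x : X) : ℝ := if stopped i h then p i h x else q i h x
  have hr (i h x) : 0 ≤ r i h x := by
    dsimp only [r]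
    split_ifs
    exacts [hp i h x, hq i h x]
  have hr_sum (i h) : ∑ x, r i h x = 1 := by
    dsimp only [r]
    split_ifs
    exacts [hp_sum i h, hq_sum i h]
  rw [← sum_prod_hist_eq_one r hr_sum, Finset.mul_sum]
  refine Finset.sum_le_sum fun x _ => ?_
  split_ifs with hx
  swap
  · rw [mul_zero]
    exact Finset.prod_nonneg fun i _ => hr _ _ _
  have hex := hE x hx
  obtain ⟨hτ, hcross⟩ := Nat.find_spec hex
  have hmin {m : ℕ} (hm : m < Nat.find hex) := Nat.find_min hex hm
  generalize Nat.find hex = τ at hτ hcross hmin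
  rw [prefixLik_castLE, prefixLik_castLE] at hcross
  have hp_split : ∏ i, p i (hist x i) (x i) =
      (∏ i : Fin t, if (i : ℕ) < τ then p i (hist x i) (x i) else 1) *
        ∏ i : Fin t, if (i : ℕ) < τ then 1 else p i (hist x i) (x i) := by
    rw [← Finset.prod_mul_distrib]
    refine Finset.prod_congr rfl fun i _ => ?_
    split_ifs <;> simp
  have hr_split : ∏ i, r i (hist x i) (x i) =
      (∏ i : Fin t, if (i : ℕ) < τ then q i (hist x i) (x i) else 1) *
        ∏ i : Fin t, if (i : ℕ) < τ then 1 else p i (hist x i) (x i) := by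
    rw [← Finset.prod_mul_distrib]
    refine Finset.prod_congr rfl fun i _ => ?_
    split_ifs with hi
    · have hns : ¬ stopped i (hist x i) := fun ⟨s, hs, hle⟩ =>
        hmin (hs.trans_lt hi) ⟨hs.trans i.isLt.le, hle⟩
      simp [r, hns]
    · have hst : stopped i (hist x i) := by
        refine ⟨τ, not_lt.mp hi, ?_⟩
        rw [← prefixLik_castLE p x hτ, ← prefixLik_castLE q x hτ] at hcross
        exact hcross
      simp [r, hst]
  rw [hp_split, hr_split, ← mul_assoc]
  refine mul_le_mul_of_nonneg_right hcross (Finset.prod_nonneg fun i _ => ?_)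
  split_ifs
  exacts [zero_le_one, hp _ _ _]

/-- The likelihood under a fixed state, as a likelihood of conditional weights. -/
theorem likOnHist_castLE {d t : ℕ} {X : Type*} [Fintype X] (S : AdaptiveScheme d X t)
    (ρ : Matrix (Fin d) (Fin d) ℂ) (x : Fin t → X) {s : ℕ} (hs : s ≤ t) :
    likOnHist S ρ s (fun j => x (Fin.castLE hs j)) =
      ∏ i : Fin t, if (i : ℕ) < s then
        bornProb (tensorPow ρ (S.n i)) (S.M i (hist x i) (x i)) else 1 :=
  prefixLik_castLE (fun i h x => bornProb (tensorPow ρ (S.n i)) (S.M i h x)) x hs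

/-- The split likelihood ratio is a quotient of the predictable likelihood of the alternative
by the maximum likelihood of the null. -/
theorem slr₀_eq_div {d t : ℕ} {X : Type*} [Fintype X] (S : AdaptiveScheme d X t)
    (est₀ est₁ : (s : ℕ) → (Fin s → X) → Matrix (Fin d) (Fin d) ℂ)
    (x : Fin t → X) {s : ℕ} (hs : s ≤ t) :
    slr₀ S est₀ est₁ x s hs =
      prefixLik (fun i h x => bornProb (tensorPow (est₁ i h) (S.n i)) (S.M i h x)) s
          (fun j => x (Fin.castLE hs j)) /
        likOnHist S (est₀ s fun j => x (Fin.castLE hs j)) s fun j => x (Fin.castLE hs j) := by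
  rw [prefixLik_castLE, likOnHist_castLE, ← Finset.prod_div_distrib, slr₀]
  refine Finset.prod_congr rfl fun i _ => ?_
  by_cases hi : (i : ℕ) < s
  · simp only [if_pos hi]
  · simp only [if_neg hi, div_one]

open Classical in
/-- two-sided test, type I error control (finite-horizon form) — under any null
state, the probability that the two-sided test rejects `H₀` is at most `ε₀`. -/
theorem two_sided_typeI_error_control {d t : ℕ} {X : Type*} [Fintype X]
    (ht : 1 ≤ t) (S : AdaptiveScheme d X t)
    (S₀ S₁ : Set (Matrix (Fin d) (Fin d) ℂ)) (hdisj : Disjoint S₀ S₁)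
    (hS₀ : ∀ ρ' ∈ S₀, IsDensityMatrix ρ') (hS₁ : ∀ ρ' ∈ S₁, IsDensityMatrix ρ')
    (est₀ est₁ : (s : ℕ) → (Fin s → X) → Matrix (Fin d) (Fin d) ℂ)
    (h₀ : IsMLEMap S S₀ est₀) (h₁ : IsMLEMap S S₁ est₁)
    (hpos : ∀ ρ' ∈ S₀ ∪ S₁, ∀ (i : Fin t) (h : Fin i → X) (x : X),
      0 < bornProb (tensorPow ρ' (S.n i)) (S.M i h x))
    (ε₀ ε₁ : ℝ) (hε₀ : ε₀ ∈ Set.Ioo (0 : ℝ) 1) (hε₁ : ε₁ ∈ Set.Ioo (0 : ℝ) 1)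
    (ρ : Matrix (Fin d) (Fin d) ℂ) (hρ : ρ ∈ S₀) :
    ∑ x : Fin t → X,
      (if RejectsNull S est₀ est₁ ε₀ ε₁ x then seqProb S ρ x else 0) ≤ ε₀ := by
  have hp (i : Fin t) (h : Fin i → X) (x : X) := hpos ρ (Or.inl hρ) i h x
  have hest₁ (i : Fin t) (h : Fin i → X) : est₁ i h ∈ S₁ := (h₁ i i.isLt.le h).1
  have ville := mul_sum_prod_hist_le_one
    (fun i h x => bornProb (tensorPow ρ (S.n i)) (S.M i h x))
    (fun i h x => bornProb (tensorPow (est₁ i h) (S.n i)) (S.M i h x))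
    (fun i h x => (hp i h x).le)
    (fun i h x => (hpos _ (Or.inr (hest₁ i h)) i h x).le)
    (fun i h => sum_bornProb_tensorPow (hS₀ ρ hρ).2 (S.hM i h))
    (fun i h => sum_bornProb_tensorPow (hS₁ _ (hest₁ i h)).2 (S.hM i h))
    (1 / ε₀) (RejectsNull S est₀ est₁ ε₀ ε₁) ?_
  · rwa [one_div, inv_mul_le_iff₀ hε₀.1, mul_one] at ville
  · rintro x ⟨s, hs, hge, -⟩
    refine ⟨s, hs, ?_⟩
    obtain ⟨hmem, hmax⟩ := h₀ s hs fun j => x (Fin.castLE hs j)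
    have hlik_pos : 0 < likOnHist S (est₀ s fun j => x (Fin.castLE hs j)) s
        fun j => x (Fin.castLE hs j) := by
      refine Finset.prod_pos fun i _ => ?_
      split_ifs
      exacts [hpos _ (Or.inl hmem) _ _ _, zero_lt_one]
    rw [slr₀_eq_div, le_div_iff₀ hlik_pos] at hge
    exact (mul_le_mul_of_nonneg_left (hmax ρ hρ) (one_div_pos.mpr hε₀.1).le).trans hge
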